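/- arXiv:2208.11917 — 2 statements merged into one kernel-verified Lean document; each statement's English description precedes it below -/
import Mathlib

section
/- For every formula φ of ConWON, every model M = (W, V), every state w ∈ W, and all contexts C₁ and C₂ for M such that C₁^τ = C₂^τ, it holds that M, C₁, w ⊨ φ if and only if M, C₂, w ⊨ φ. -/
open Classical in
/-- Greedy intersection: keep intersecting with successive defaults as long as nonempty. -/
noncomputable def eAux {W : Type*} : Set W → List (Set W) → Set W
  | A, [] => A
  | A, E :: rest => if (A ∩ E).Nonempty then eAux (A ∩ E) rest else A

/-- Expected states of a context (list of defaults). -/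
noncomputable def expect {W : Type*} : List (Set W) → Set W
  | [] => Set.univ
  | D :: rest => eAux D rest

/-- Propositional formulas over a countable set of atoms (identified with ℕ). -/
inductive PForm : Type
  | atom : ℕ → PForm
  | fls : PForm
  | neg : PForm → PForm
  | conj : PForm → PForm → PForm

/-- The language ConWON: propositional connectives plus the conditional [α]φ
with propositional antecedent. -/
inductive Form : Type
  | atom : ℕ → Form
  | fls : Form
  | neg : Form → Form
  | conj : Form → Form → Form
  | cond : PForm → Form → Form

/-- Extension ⟦α⟧ of a propositional formula in a model (W, V). -/
def pval {W : Type*} (V : ℕ → Set W) : PForm → Set W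
  | .atom n => V n
  | .fls => ∅
  | .neg a => (pval V a)ᶜ
  | .conj a b => pval V a ∩ pval V b

/-- Truth at a contextualized pointed model: M,C,w ⊨ φ. -/
def sat {W : Type*} (V : ℕ → Set W) : List (Set W) → W → Form → Prop
  | _, w, .atom n => w ∈ V n
  | _, _, .fls => False
  | C, w, .neg φ => ¬ sat V C w φ
  | C, w, .conj φ ψ => sat V C w φ ∧ sat V C w ψ
  | C, _, .cond α φ => ∀ u ∈ expect (pval V α :: C), sat V (pval V α :: C) u φ

universe u

/-- Validity in ConWON: truth at every contextualized pointed model. -/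
def valid (φ : Form) : Prop :=
  ∀ (W : Type u) (_ : Nonempty W) (V : ℕ → Set W) (C : List (Set W)),
    C ≠ [] → ∀ w : W, sat V C w φ

def Form.top : Form := .neg .fls
def Form.or (φ ψ : Form) : Form := .neg (.conj (.neg φ) (.neg ψ))
def Form.imp (φ ψ : Form) : Form := .neg (.conj φ (.neg ψ))
def Form.iff (φ ψ : Form) : Form := .conj (.imp φ ψ) (.imp ψ φ)
/-- ⟨α⟩φ := ¬[α]¬φ. -/
def Form.dia (α : PForm) (φ : Form) : Form := .neg (.cond α (.neg φ))
/-- Eα := ⟨α⟩⊤. -/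
def Form.E (α : PForm) : Form := Form.dia α Form.top
/-- Aα := ¬E¬α. -/
def Form.A (α : PForm) : Form := .neg (Form.E (.neg α))
def PForm.imp (a b : PForm) : PForm := .neg (.conj a (.neg b))

/-- Embedding of propositional formulas into ConWON. -/
def pToForm : PForm → Form
  | .atom n => .atom n
  | .fls => .fls
  | .neg a => .neg (pToForm a)
  | .conj a b => .conj (pToForm a) (pToForm b)

/-- Closed formulas: χ ::= [α]φ | ¬χ | (χ∧χ). -/
inductive Closed : Form → Prop
  | cond (α : PForm) (φ : Form) : Closed (.cond α φ)
  | neg {χ : Form} : Closed χ → Closed (.neg χ)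
  | conj {χ₁ χ₂ : Form} : Closed χ₁ → Closed χ₂ → Closed (.conj χ₁ χ₂)

/-- Conditional-free formulas of ConWON. -/
def CondFree : Form → Prop
  | .atom _ => True
  | .fls => True
  | .neg φ => CondFree φ
  | .conj φ ψ => CondFree φ ∧ CondFree ψ
  | .cond _ _ => False

/-- The flat fragment ConWON-1: no conditional occurs inside another conditional. -/
def Flat : Form → Prop
  | .atom _ => True
  | .fls => True
  | .neg φ => Flat φ
  | .conj φ ψ => Flat φ ∧ Flat ψ
  | .cond _ φ => CondFree φ

open Classical in
/-- Core of a context: keep only the leftmost occurrence of each default. -/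
noncomputable def core {W : Type*} : List (Set W) → List (Set W)
  | [] => []
  | D :: rest => D :: (core rest).filter (fun E => decide (E ≠ D))

theorem eAux_empty {W : Type*} (l : List (Set W)) : eAux ∅ l = ∅ := by
  cases l <;> simp [eAux]

open Classical in
/-- Defaults already implied by the current intersection can be dropped. -/
theorem eAux_filter_ne {W : Type*} {A D : Set W} (h : A ⊆ D) (l : List (Set W)) :
    eAux A (l.filter (fun E => decide (E ≠ D))) = eAux A l := by
  induction l generalizing A with
  | nil => rfl
  | cons E l ih =>
    by_cases hE : E = D
    · subst hE
      rcases A.eq_empty_or_nonempty with rfl | hA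
      · simp only [eAux_empty]
      · have hAE : A ∩ E = A := Set.inter_eq_left.2 h
        simpa [eAux, hAE, hA] using ih h
    · have ih' := ih (Set.inter_subset_left.trans h : A ∩ E ⊆ D)
      rw [List.filter_cons_of_pos (by simpa using hE)]
      simp only [eAux, ih']

theorem eAux_core {W : Type*} (A : Set W) (l : List (Set W)) : eAux A (core l) = eAux A l := by
  induction l generalizing A with
  | nil => rfl
  | cons D l ih =>
    simp only [core, eAux, eAux_filter_ne (Set.inter_subset_right : A ∩ D ⊆ D), ih]

theorem expect_core {W : Type*} (C : List (Set W)) : expect (core C) = expect C := by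
  cases C with
  | nil => rfl
  | cons D C => simp only [core, expect, eAux_filter_ne subset_rfl, eAux_core]

/-- Truth of ConWON formulas only depends on the core of the context:
if C₁^τ = C₂^τ then M,C₁,w ⊨ φ iff M,C₂,w ⊨ φ. -/
theorem sat_of_core_eq (φ : Form) (W : Type*) [Nonempty W] (V : ℕ → Set W)
    (C₁ C₂ : List (Set W)) (h₁ : C₁ ≠ []) (h₂ : C₂ ≠ []) (hcore : core C₁ = core C₂)
    (w : W) : sat V C₁ w φ ↔ sat V C₂ w φ := by
  induction φ generalizing C₁ C₂ w with
  | atom n => simp only [sat]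
  | fls => simp only [sat]
  | neg φ ih => simp only [sat, ih C₁ C₂ h₁ h₂ hcore w]
  | conj φ ψ ihφ ihψ => simp only [sat, ihφ C₁ C₂ h₁ h₂ hcore w, ihψ C₁ C₂ h₁ h₂ hcore w]
  | cond α φ ih =>
    have hc : core (pval V α :: C₁) = core (pval V α :: C₂) := by simp only [core, hcore]
    have he : expect (pval V α :: C₁) = expect (pval V α :: C₂) := by
      rw [← expect_core, hc, expect_core]
    simp only [sat, he]
    exact forall₂_congr fun u _ => ih _ _ (List.cons_ne_nil _ _) (List.cons_ne_nil _ _) hc u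
end

section
/- For all propositional formulas α, β and γ, the formula [α][β]γ ↔ (Eα → ((E(α∧β) ∧ [α∧β]γ) ∨ (¬E(α∧β) ∧ A(β→γ)))) is valid in ConWON. -/
universe u

theorem eAux_nonempty_iff {W : Type*} (A : Set W) (C : List (Set W)) :
    (eAux A C).Nonempty ↔ A.Nonempty := by
  induction C generalizing A with
  | nil => rfl
  | cons D C ih =>
    rw [eAux]
    split_ifs with h
    · rw [ih]
      exact ⟨fun _ => h.left, fun _ => h⟩
    · rfl

section Semantics

variable {W : Type*} (V : ℕ → Set W) (C : List (Set W)) (w : W)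

theorem sat_neg (φ : Form) : sat V C w φ.neg ↔ ¬ sat V C w φ := Iff.rfl

theorem sat_conj (φ ψ : Form) : sat V C w (φ.conj ψ) ↔ sat V C w φ ∧ sat V C w ψ := Iff.rfl

theorem sat_cond (α : PForm) (φ : Form) :
    sat V C w (.cond α φ) ↔ ∀ u ∈ eAux (pval V α) C, sat V (pval V α :: C) u φ := Iff.rfl

theorem sat_or (φ ψ : Form) : sat V C w (φ.or ψ) ↔ sat V C w φ ∨ sat V C w ψ := by
  simp only [Form.or, sat_neg, sat_conj]
  tauto

theorem sat_imp (φ ψ : Form) : sat V C w (φ.imp ψ) ↔ (sat V C w φ → sat V C w ψ) := by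
  simp only [Form.imp, sat_neg, sat_conj]
  tauto

theorem sat_iff (φ ψ : Form) : sat V C w (φ.iff ψ) ↔ (sat V C w φ ↔ sat V C w ψ) := by
  rw [Form.iff, sat_conj, sat_imp, sat_imp]
  exact iff_iff_implies_and_implies.symm

theorem sat_E (α : PForm) : sat V C w (Form.E α) ↔ (pval V α).Nonempty := by
  rw [← eAux_nonempty_iff _ C]
  simp [Form.E, Form.dia, Form.top, sat, expect, Set.Nonempty]

theorem sat_A (α : PForm) : sat V C w (Form.A α) ↔ ∀ u, u ∈ pval V α := by
  simp [Form.A, sat_neg, sat_E, pval, Set.Nonempty]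

theorem mem_pval_imp (α β : PForm) :
    w ∈ pval V (α.imp β) ↔ (w ∈ pval V α → w ∈ pval V β) := by
  simp [PForm.imp, pval]

theorem sat_pToForm (γ : PForm) : sat V C w (pToForm γ) ↔ w ∈ pval V γ := by
  induction γ with
  | atom n => rfl
  | fls => rfl
  | neg a ih => exact not_congr ih
  | conj a b iha ihb => exact and_congr iha ihb

end Semantics

/-- [α][β]γ ↔ (Eα → ((E(α∧β) ∧ [α∧β]γ) ∨ (¬E(α∧β) ∧ A(β→γ)))) is valid in ConWON. -/
theorem valid_cond_cond (α β γ : PForm) :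
    valid (Form.iff (.cond α (.cond β (pToForm γ)))
      (Form.imp (Form.E α)
        (Form.or
          (Form.conj (Form.E (.conj α β)) (.cond (.conj α β) (pToForm γ)))
          (Form.conj (.neg (Form.E (.conj α β))) (Form.A (PForm.imp β γ)))))) := by
  intro W _ V C _ w
  simp only [sat_iff, sat_imp, sat_or, sat_conj, sat_neg, sat_E, sat_A, sat_cond, sat_pToForm,
    mem_pval_imp]
  have vacuous (P : Prop) : (∀ u ∈ eAux (pval V α) C, P) ↔ ((pval V α).Nonempty → P) := by
    rw [← eAux_nonempty_iff _ C]
    exact ⟨fun h ⟨u, hu⟩ => h u hu, fun h u hu => h ⟨u, hu⟩⟩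
  rw [vacuous]
  refine imp_congr_right fun _ => ?_
  rw [eAux, Set.inter_comm, ← pval]
  split_ifs with h <;> simp [h]
end
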